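/- Let N be a positive integer, let A₀ and B₀ be N×N complex matrices, and let u, v ∈ ℂᴺ. Let σ_p and σ_q be simple generalized eigenvalues of the pencil (A₀, B₀) with normalized eigenvector/adjoint-eigenvector pairs (φ_p, ψ_p) and (φ_q, ψ_q) respectively, and suppose vᵀ·adj(σ_j B₀ − A₀)·u ≠ 0 for j = p, q. Define f_A(σ) = −det(σB₀ − A₀)/(vᵀ·adj(σB₀ − A₀)·u) near σ_p and σ_q, and set χ_{ij} = ψ̄_iᵀ·(u·vᵀ)·φ_j. Then χ_{pp}·χ_{qq} = χ_{pq}·χ_{qp} = 1/(f_A′(σ_q)·f_A′(σ_p)), where f_A′ denotes the complex derivative of f_A. -/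

import Mathlib

open Matrix

open Filter Topology

section RankOnePencil

theorem continuous_pencil {m 𝕜 : Type*} [NontriviallyNormedField 𝕜] (A B : Matrix m m 𝕜) : Continuous fun τ : 𝕜 => τ • B - A := by
  fun_prop

variable {n 𝕜 : Type*} [Fintype n] [DecidableEq n] [NontriviallyNormedField 𝕜]

theorem det_add_vecMulVec_of_det_ne_zero {A : Matrix n n 𝕜} (hA : A.det ≠ 0) (u v : n → 𝕜) :
    (A + vecMulVec u v).det = A.det + v ⬝ᵥ (A.adjugate *ᵥ u) := by
  rw [vecMulVec_eq Unit,
    det_add_replicateCol_mul_replicateRow hA.isUnit, det_unique (n := Unit), Matrix.mul_assoc, inv_def,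
    Matrix.smul_mul, Matrix.mul_smul, Ring.inverse_eq_inv, ← replicateCol_mulVec]
  simp only [Matrix.add_apply, Matrix.smul_apply, one_apply_eq, replicateRow_mul_replicateCol_apply, smul_eq_mul]
  field_simp

/-- The determinant lemma at a root of the pencil, obtained from nearby nonsingular matrices. -/
theorem det_pencil_add_vecMulVec {A B : Matrix n n 𝕜} {σ : 𝕜}
    (h0 : (σ • B - A).det = 0) (hs : deriv (fun τ : 𝕜 => (τ • B - A).det) σ ≠ 0) (u v : n → 𝕜) :
    (σ • B - A + vecMulVec u v).det = v ⬝ᵥ ((σ • B - A).adjugate *ᵥ u) := by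
  have hc := continuous_pencil A B
  have hne : ∀ᶠ τ in 𝓝[≠] σ, (τ • B - A).det ≠ 0 :=
    (differentiableAt_of_deriv_ne_zero hs).hasDerivAt.eventually_ne hs
  have hl : Tendsto (fun τ : 𝕜 => (τ • B - A + vecMulVec u v).det) (𝓝[≠] σ)
      (𝓝 (σ • B - A + vecMulVec u v).det) :=
    ((hc.add continuous_const).matrix_det.tendsto σ).mono_left nhdsWithin_le_nhds
  have hr : Tendsto (fun τ : 𝕜 => (τ • B - A).det + v ⬝ᵥ ((τ • B - A).adjugate *ᵥ u)) (𝓝[≠] σ)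
      (𝓝 ((σ • B - A).det + v ⬝ᵥ ((σ • B - A).adjugate *ᵥ u))) :=
    ((hc.matrix_det.add (continuous_const.dotProduct
      (hc.matrix_adjugate.matrix_mulVec continuous_const))).tendsto σ).mono_left nhdsWithin_le_nhds
  rw [h0, zero_add] at hr
  refine tendsto_nhds_unique hl (hr.congr' ?_)
  filter_upwards [hne] with τ hτ
  exact (det_add_vecMulVec_of_det_ne_zero hτ u v).symm

theorem smul_eq_smul_of_mulVec_eq_zero {M : Matrix n n 𝕜} {u v : n → 𝕜}
    (hK : (M + vecMulVec u v).det ≠ 0) {x y : n → 𝕜} (hx : M *ᵥ x = 0) (hy : M *ᵥ y = 0) :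
    (v ⬝ᵥ y) • x = (v ⬝ᵥ x) • y := by
  refine mulVec_injective_of_isUnit ((isUnit_iff_isUnit_det _).2 hK.isUnit) ?_
  simp only [mulVec_smul, add_mulVec, hx, hy, vecMulVec_mulVec, zero_add]
  ext i
  simp
  ring

theorem deriv_det_pencil_mul_dotProduct {A B : Matrix n n 𝕜} {σ : 𝕜}
    (h0 : (σ • B - A).det = 0) (hs : deriv (fun τ : 𝕜 => (τ • B - A).det) σ ≠ 0)
    {y : n → 𝕜} (hy : y ᵥ* (σ • B - A) = 0) (u : n → 𝕜) :
    deriv (fun τ : 𝕜 => (τ • B - A).det) σ * (y ⬝ᵥ u)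
      = y ⬝ᵥ (B *ᵥ ((σ • B - A).adjugate *ᵥ u)) := by
  have hl := (hasDerivAt_iff_tendsto_slope.1
    (differentiableAt_of_deriv_ne_zero hs).hasDerivAt).mul_const (y ⬝ᵥ u)
  have hr : Tendsto (fun τ : 𝕜 => y ⬝ᵥ (B *ᵥ ((τ • B - A).adjugate *ᵥ u))) (𝓝[≠] σ)
      (𝓝 (y ⬝ᵥ (B *ᵥ ((σ • B - A).adjugate *ᵥ u)))) :=
    ((continuous_const.dotProduct (continuous_const.matrix_mulVec
      ((continuous_pencil A B).matrix_adjugate.matrix_mulVec continuous_const))).tendsto σ).mono_left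
        nhdsWithin_le_nhds
  refine tendsto_nhds_unique hl (hr.congr' ?_)
  filter_upwards [self_mem_nhdsWithin] with τ hτ
  have hτ' : τ - σ ≠ 0 := sub_ne_zero.2 hτ
  have hvec : y ᵥ* (τ • B - A) = (τ - σ) • (y ᵥ* B) := by
    rw [show τ • B - A = (σ • B - A) + (τ - σ) • B by rw [sub_smul]; abel, vecMul_add, hy,
      zero_add, vecMul_smul]
  have key : (τ • B - A).det * (y ⬝ᵥ u)
      = (τ - σ) * (y ⬝ᵥ (B *ᵥ ((τ • B - A).adjugate *ᵥ u))) := by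
    calc (τ • B - A).det * (y ⬝ᵥ u)
        = y ⬝ᵥ ((τ • B - A) *ᵥ ((τ • B - A).adjugate *ᵥ u)) := by
          rw [mulVec_mulVec, mul_adjugate, smul_mulVec, one_mulVec, dotProduct_smul, smul_eq_mul]
      _ = _ := by
          rw [dotProduct_mulVec, hvec, smul_dotProduct, smul_eq_mul, ← dotProduct_mulVec]
  rw [slope_def_field, h0, sub_zero, div_mul_eq_mul_div, key, mul_div_cancel_left₀ _ hτ']

theorem deriv_neg_div_of_eq_zero {h g : 𝕜 → 𝕜} {σ : 𝕜} (h0 : h σ = 0)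
    (hh : DifferentiableAt 𝕜 h σ) (hg : ContinuousAt g σ) (hgσ : g σ ≠ 0) :
    deriv (fun τ => -h τ / g τ) σ = -deriv h σ / g σ := by
  refine HasDerivAt.deriv (hasDerivAt_iff_tendsto_slope.2 ?_)
  refine ((hasDerivAt_iff_tendsto_slope.1 hh.hasDerivAt).neg.div
    (hg.mono_left nhdsWithin_le_nhds) hgσ).congr fun τ => ?_
  simp only [Pi.div_apply, slope_def_field, h0]
  ring

/-- At a simple root with normalized eigenvectors `x`, `y`, the coefficient `(y ⬝ u) (v ⬝ x)` is
minus the reciprocal of the derivative of `-det / (v ⬝ adj u)`. -/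
theorem dotProduct_vecMulVec_mulVec_eq_neg_inv_deriv {A B : Matrix n n 𝕜} {u v x y : n → 𝕜} {σ : 𝕜}
    (h0 : (σ • B - A).det = 0) (hs : deriv (fun τ : 𝕜 => (τ • B - A).det) σ ≠ 0)
    (hx : A *ᵥ x = σ • (B *ᵥ x)) (hy : y ᵥ* (σ • B - A) = 0) (hxy : y ⬝ᵥ (B *ᵥ x) = 1)
    (hadj : v ⬝ᵥ ((σ • B - A).adjugate *ᵥ u) ≠ 0) :
    y ⬝ᵥ (vecMulVec u v *ᵥ x)
      = -(deriv (fun τ : 𝕜 => -(τ • B - A).det / (v ⬝ᵥ ((τ • B - A).adjugate *ᵥ u))) σ)⁻¹ := by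
  have hK : (σ • B - A + vecMulVec u v).det ≠ 0 := by rwa [det_pencil_add_vecMulVec h0 hs]
  have hx' : (σ • B - A) *ᵥ x = 0 := by rw [sub_mulVec, smul_mulVec, hx, sub_self]
  have hw : (σ • B - A) *ᵥ ((σ • B - A).adjugate *ᵥ u) = 0 := by
    rw [mulVec_mulVec, mul_adjugate, h0, zero_smul, zero_mulVec]
  have hker := congrArg (fun z => y ⬝ᵥ (B *ᵥ z)) (smul_eq_smul_of_mulVec_eq_zero hK hw hx')
  simp only [mulVec_smul, dotProduct_smul, smul_eq_mul, hxy, mul_one,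
    ← deriv_det_pencil_mul_dotProduct h0 hs hy] at hker
  have hg : Continuous fun τ : 𝕜 => v ⬝ᵥ ((τ • B - A).adjugate *ᵥ u) :=
    continuous_const.dotProduct
      ((continuous_pencil A B).matrix_adjugate.matrix_mulVec continuous_const)
  rw [deriv_neg_div_of_eq_zero h0 (differentiableAt_of_deriv_ne_zero hs) hg.continuousAt hadj,
    ← hker, vecMulVec_mulVec]
  rw [← hker] at hadj
  have hvx := left_ne_zero_of_mul hadj
  have hyu := right_ne_zero_of_mul (right_ne_zero_of_mul hadj)
  simp only [op_smul_eq_smul, dotProduct_smul, smul_eq_mul]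
  field_simp

end RankOnePencil

/-- For a rank-one perturbation `A₁ = u·vᵀ` and two simple generalized
eigenvalues `σ_p, σ_q` with normalized pairs `(φ_p, ψ_p)`, `(φ_q, ψ_q)`,
the coefficients `χ_{ij} = ψ̄_iᵀ·(u·vᵀ)·φ_j` satisfy
`χ_{pp}χ_{qq} = χ_{pq}χ_{qp} = 1/(f_A′(σ_q)·f_A′(σ_p))`, where
`f_A(σ) = −det(σB₀ − A₀)/(vᵀ·adj(σB₀ − A₀)·u)`. -/
theorem stmt_11 (N : ℕ) (hN : 0 < N) (A₀ B₀ : Matrix (Fin N) (Fin N) ℂ)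
    (u v : Fin N → ℂ) (σp σq : ℂ)
    (h0p : (σp • B₀ - A₀).det = 0)
    (hsp : deriv (fun σ : ℂ => (σ • B₀ - A₀).det) σp ≠ 0)
    (h0q : (σq • B₀ - A₀).det = 0)
    (hsq : deriv (fun σ : ℂ => (σ • B₀ - A₀).det) σq ≠ 0)
    (φp ψp φq ψq : Fin N → ℂ)
    (hφp : A₀ *ᵥ φp = σp • (B₀ *ᵥ φp))
    (hψp : star ψp ᵥ* (σp • B₀ - A₀) = 0)
    (hnormp : star ψp ⬝ᵥ (B₀ *ᵥ φp) = 1)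
    (hφq : A₀ *ᵥ φq = σq • (B₀ *ᵥ φq))
    (hψq : star ψq ᵥ* (σq • B₀ - A₀) = 0)
    (hnormq : star ψq ⬝ᵥ (B₀ *ᵥ φq) = 1)
    (hadjp : v ⬝ᵥ ((σp • B₀ - A₀).adjugate *ᵥ u) ≠ 0)
    (hadjq : v ⬝ᵥ ((σq • B₀ - A₀).adjugate *ᵥ u) ≠ 0) :
    (star ψp ⬝ᵥ (vecMulVec u v *ᵥ φp)) * (star ψq ⬝ᵥ (vecMulVec u v *ᵥ φq))
        = (star ψp ⬝ᵥ (vecMulVec u v *ᵥ φq)) * (star ψq ⬝ᵥ (vecMulVec u v *ᵥ φp))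
      ∧
      (star ψp ⬝ᵥ (vecMulVec u v *ᵥ φq)) * (star ψq ⬝ᵥ (vecMulVec u v *ᵥ φp))
        = 1 / (deriv (fun σ : ℂ =>
              -(σ • B₀ - A₀).det / (v ⬝ᵥ ((σ • B₀ - A₀).adjugate *ᵥ u))) σq
            * deriv (fun σ : ℂ =>
              -(σ • B₀ - A₀).det / (v ⬝ᵥ ((σ • B₀ - A₀).adjugate *ᵥ u))) σp) := by
  have hp := dotProduct_vecMulVec_mulVec_eq_neg_inv_deriv h0p hsp hφp hψp hnormp hadjp
  have hq := dotProduct_vecMulVec_mulVec_eq_neg_inv_deriv h0q hsq hφq hψq hnormq hadjq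
  have hswap : (star ψp ⬝ᵥ (vecMulVec u v *ᵥ φp)) * (star ψq ⬝ᵥ (vecMulVec u v *ᵥ φq))
      = (star ψp ⬝ᵥ (vecMulVec u v *ᵥ φq)) * (star ψq ⬝ᵥ (vecMulVec u v *ᵥ φp)) := by
    simp only [vecMulVec_mulVec, op_smul_eq_smul, dotProduct_smul, smul_eq_mul]
    ring
  refine ⟨hswap, ?_⟩
  rw [← hswap, hp, hq, neg_mul_neg, one_div, mul_inv, mul_comm]
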